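/- Let G=(V,E) be a finite simple undirected graph with preferences as described, assume P≠∅, and let x∈P. Let e={v,w} be an edge in E⁺. Then e ∈ W_x(v) if and only if e ∈ B_x(w). -/

import Mathlib

/-!
Common setup: a finite simple undirected graph `G = (V, E)` where edges are
elements of `Sym2 V`, together with, for each vertex `v`, a complete and
transitive preference relation `pref v` on `E(v) ∪ {∅}` (the unmatched
option `∅` is encoded as `none : Option (Sym2 V)`), where every incident
edge is strictly preferred to `∅`.
-/

/-- A roommates instance: a finite simple graph with preferences. -/
structure RSetup (V : Type*) [Fintype V] [DecidableEq V] where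
  /-- the edge set -/
  E : Finset (Sym2 V)
  /-- the graph is simple: no loops -/
  not_diag : ∀ e ∈ E, ¬ e.IsDiag
  /-- the preference relation `≿ᵥ` of each vertex, on `E(v) ∪ {∅}` -/
  pref : V → Option (Sym2 V) → Option (Sym2 V) → Prop
  /-- completeness of `≿ᵥ` on `E(v) ∪ {∅}` -/
  pref_total : ∀ v : V, ∀ a b : Option (Sym2 V),
    (∀ e, a = some e → e ∈ E ∧ v ∈ e) → (∀ e, b = some e → e ∈ E ∧ v ∈ e) →
    pref v a b ∨ pref v b a
  /-- transitivity of `≿ᵥ` on `E(v) ∪ {∅}` -/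
  pref_trans : ∀ v : V, ∀ a b c : Option (Sym2 V),
    (∀ e, a = some e → e ∈ E ∧ v ∈ e) → (∀ e, b = some e → e ∈ E ∧ v ∈ e) →
    (∀ e, c = some e → e ∈ E ∧ v ∈ e) →
    pref v a b → pref v b c → pref v a c
  /-- every incident edge is strictly preferred to being unmatched -/
  pref_none : ∀ v : V, ∀ e ∈ E, v ∈ e →
    pref v (some e) none ∧ ¬ pref v none (some e)

namespace RSetup

variable {V : Type*} [Fintype V] [DecidableEq V] (S : RSetup V)

/-- `a ≻ᵥ b` : strict preference. -/
def SPref (v : V) (a b : Option (Sym2 V)) : Prop :=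
  S.pref v a b ∧ ¬ S.pref v b a

/-- `a ∼ᵥ b` : indifference. -/
def IPref (v : V) (a b : Option (Sym2 V)) : Prop :=
  S.pref v a b ∧ S.pref v b a

/-- `F(v)` : the set of edges in `F` incident to `v`. -/
def inc (F : Finset (Sym2 V)) (v : V) : Finset (Sym2 V) :=
  F.filter (fun e => v ∈ e)

/-- a matching in `G` -/
def IsMatching (μ : Finset (Sym2 V)) : Prop :=
  μ ⊆ S.E ∧ ∀ v : V, (inc μ v).card ≤ 1

/-- `μ(v)` : the edge of `μ` incident to `v` (or `none`). -/
noncomputable def matchOf (μ : Finset (Sym2 V)) (v : V) : Option (Sym2 V) :=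
  (inc μ v).toList.head?

/-- `e` blocks the matching `μ`. -/
def Blocks (μ : Finset (Sym2 V)) (e : Sym2 V) : Prop :=
  e ∈ S.E ∧ e ∉ μ ∧ (∀ v ∈ e, S.pref v (some e) (matchOf μ v)) ∧
    (∃ v ∈ e, S.SPref v (some e) (matchOf μ v))

/-- a strongly stable matching in `G` -/
def StronglyStable (μ : Finset (Sym2 V)) : Prop :=
  S.IsMatching μ ∧ ∀ e : Sym2 V, ¬ S.Blocks μ e

/-- `x(W) = ∑_{e ∈ W} x(e)` -/
def xS (x : Sym2 V → ℝ) (W : Finset (Sym2 V)) : ℝ := ∑ e ∈ W, x e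

/-- `x ∈ ℝ₊^E`, encoded as a nonnegative function on `Sym2 V` vanishing
outside `E`. -/
def IsVec (x : Sym2 V → ℝ) : Prop :=
  (∀ e, 0 ≤ x e) ∧ ∀ e ∉ S.E, x e = 0

open Classical in
/-- `E[∼ᵥ e] = {f ∈ E(v) : f ∼ᵥ e}` -/
noncomputable def simSet (v : V) (e : Sym2 V) : Finset (Sym2 V) :=
  (inc S.E v).filter (fun f => S.IPref v (some f) (some e))

open Classical in
/-- `E[≻ᵥ e] = {f ∈ E(v) : f ≻ᵥ e}` -/
noncomputable def succSet (v : V) (e : Sym2 V) : Finset (Sym2 V) :=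
  (inc S.E v).filter (fun f => S.SPref v (some f) (some e))

open Classical in
/-- `E⟨X⟩ = {e ∈ E : e ⊆ X}` -/
noncomputable def esub (X : Finset V) : Finset (Sym2 V) :=
  S.E.filter (fun e => ∀ u ∈ e, u ∈ X)

/-- constraint (1): `x(E(v)) ≤ 1` for every vertex `v` -/
def C1 (x : Sym2 V → ℝ) : Prop := ∀ v : V, xS x (inc S.E v) ≤ 1

/-- constraint (2): `x(E[∼ᵥ e]) + ∑_{w ∈ e} x(E[≻_w e]) ≥ 1`
for every edge `e ∈ E` and `v ∈ e` -/
def C2 (x : Sym2 V → ℝ) : Prop := ∀ v w : V, s(v, w) ∈ S.E →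
  xS x (S.simSet v s(v, w)) +
    (xS x (S.succSet v s(v, w)) + xS x (S.succSet w s(v, w))) ≥ 1

/-- constraint (3): `x(E⟨X⟩) ≤ ⌊|X|/2⌋` for every odd `X ⊆ V` -/
def C3 (x : Sym2 V → ℝ) : Prop := ∀ X : Finset V, Odd X.card →
  xS x (S.esub X) ≤ ((X.card / 2 : ℕ) : ℝ)

/-- membership in the polytope `P` -/
def memP (x : Sym2 V → ℝ) : Prop := S.IsVec x ∧ S.C1 x ∧ S.C2 x ∧ S.C3 x

/-- the characteristic vector `χ_μ` of a set of edges -/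
def chi (μ : Finset (Sym2 V)) : Sym2 V → ℝ := fun e => if e ∈ μ then 1 else 0

open Classical in
/-- `E_x = {e ∈ E : x(e) > 0}` -/
noncomputable def supp (x : Sym2 V → ℝ) : Finset (Sym2 V) :=
  S.E.filter (fun e => 0 < x e)

/-- `V₁` : the set of vertices `v` with `x(E(v)) > 0` for some `x ∈ P` -/
def V1 : Set V := {v : V | ∃ x : Sym2 V → ℝ, S.memP x ∧ 0 < xS x (inc S.E v)}

open Classical in
/-- `B_x(v)` : the best edges in `E_x(v)` for `v` -/
noncomputable def Bset (x : Sym2 V → ℝ) (v : V) : Finset (Sym2 V) :=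
  (inc (S.supp x) v).filter
    (fun e => ∀ f ∈ inc (S.supp x) v, S.pref v (some e) (some f))

open Classical in
/-- `W_x(v)` : the worst edges in `E_x(v)` for `v` -/
noncomputable def Wset (x : Sym2 V → ℝ) (v : V) : Finset (Sym2 V) :=
  (inc (S.supp x) v).filter
    (fun e => ∀ f ∈ inc (S.supp x) v, S.pref v (some f) (some e))

/-- a nonempty `F ⊆ E(v)` is flat if `v` is indifferent among its members -/
def Flat (v : V) (F : Finset (Sym2 V)) : Prop :=
  F.Nonempty ∧ ∀ e ∈ F, ∀ f ∈ F, S.IPref v (some e) (some f)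

open Classical in
/-- `T_x` : edges `e ∈ E⟨V₁⟩` such that, for each `v ∈ e`, either
`e ∈ B_x(v) ∪ W_x(v)` or `B_x(v) ≻ᵥ e ≻ᵥ W_x(v)`. -/
noncomputable def Tset (x : Sym2 V → ℝ) : Finset (Sym2 V) :=
  (S.E.filter (fun e => ∀ u ∈ e, u ∈ S.V1)).filter (fun e => ∀ v ∈ e,
    (e ∈ S.Bset x v ∪ S.Wset x v) ∨
      ((∀ f ∈ S.Bset x v, S.SPref v (some f) (some e)) ∧
        (∀ f ∈ S.Wset x v, S.SPref v (some e) (some f))))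

/-- membership in `P(F) = {x ∈ P : x(e) = 0 for all e ∈ E \ F}` -/
def memPF (F : Finset (Sym2 V)) (x : Sym2 V → ℝ) : Prop :=
  S.memP x ∧ ∀ e ∈ S.E, e ∉ F → x e = 0

open Classical in
/-- `E⁺ = {e ∈ E : e ∈ E_z for some z ∈ P}` -/
noncomputable def Eplus : Finset (Sym2 V) :=
  S.E.filter (fun e => ∃ z : Sym2 V → ℝ, S.memP z ∧ 0 < z e)

open Classical in
/-- `P'` : given `x ∈ P` and a strongly stable matching `σ`, the set of
vertices `v ∈ V₁` with `W_x(v) ≻ᵥ σ(v)`, or with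
`B_x(v) ≻ᵥ W_x(v)` and `W_x(v) ∼ᵥ σ(v)`. -/
def Pset (x : Sym2 V → ℝ) (σ : Finset (Sym2 V)) : Set V :=
  {v : V | v ∈ S.V1 ∧
    ((∀ f ∈ S.Wset x v, S.SPref v (some f) (matchOf σ v)) ∨
      ((∀ f ∈ S.Bset x v, ∀ g ∈ S.Wset x v, S.SPref v (some f) (some g)) ∧
        (∀ f ∈ S.Wset x v, S.IPref v (some f) (matchOf σ v))))}

/-- `Q'` : given `x ∈ P` and a strongly stable matching `σ`, the set of
vertices `v ∈ V₁` with `σ(v) ≻ᵥ B_x(v)`, or with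
`B_x(v) ≻ᵥ W_x(v)` and `B_x(v) ∼ᵥ σ(v)`. -/
def Qset (x : Sym2 V → ℝ) (σ : Finset (Sym2 V)) : Set V :=
  {v : V | v ∈ S.V1 ∧
    ((∀ f ∈ S.Bset x v, S.SPref v (matchOf σ v) (some f)) ∨
      ((∀ f ∈ S.Bset x v, ∀ g ∈ S.Wset x v, S.SPref v (some f) (some g)) ∧
        (∀ f ∈ S.Bset x v, S.IPref v (some f) (matchOf σ v))))}

/-- `R'` : given `x ∈ P` and a strongly stable matching `σ`, the set of
vertices `v ∈ V₁` such that `E_x(v)` is flat and `E_x(v) ∼ᵥ σ(v)`. -/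
def Rset (x : Sym2 V → ℝ) (σ : Finset (Sym2 V)) : Set V :=
  {v : V | v ∈ S.V1 ∧ S.Flat v (inc (S.supp x) v) ∧
    ∀ f ∈ inc (S.supp x) v, S.IPref v (some f) (matchOf σ v)}

end RSetup

namespace RSetup

lemma mem_inc {V : Type*} [DecidableEq V] {F : Finset (Sym2 V)} {v : V} {e : Sym2 V} :
    e ∈ inc F v ↔ e ∈ F ∧ v ∈ e := by
  simp [inc]

variable {V : Type*} [Fintype V] [DecidableEq V] {S : RSetup V}

lemma pref_or_pref {v : V} {e f : Sym2 V} (he : e ∈ inc S.E v) (hf : f ∈ inc S.E v) :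
    S.pref v (some e) (some f) ∨ S.pref v (some f) (some e) := by
  rw [mem_inc] at he hf
  refine S.pref_total v _ _ ?_ ?_
  · rintro _ ⟨⟩; exact he
  · rintro _ ⟨⟩; exact hf

open Classical in
variable (S) in
/-- `E[≺ᵥ e] = {f ∈ E(v) : e ≻ᵥ f}` -/
noncomputable def precSet (v : V) (e : Sym2 V) : Finset (Sym2 V) :=
  (inc S.E v).filter (fun f => S.SPref v (some e) (some f))

open Classical in
lemma xS_inc_eq_add (x : Sym2 V → ℝ) {v : V} {e : Sym2 V} (he : e ∈ inc S.E v) :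
    xS x (inc S.E v) = xS x (S.simSet v e) + xS x (S.succSet v e) + xS x (S.precSet v e) := by
  simp only [xS, simSet, succSet, precSet, Finset.sum_filter, ← Finset.sum_add_distrib]
  refine Finset.sum_congr rfl fun f hf => ?_
  have := pref_or_pref he hf
  by_cases h1 : S.pref v (some e) (some f) <;> by_cases h2 : S.pref v (some f) (some e) <;>
    simp_all [IPref, SPref]

open Classical in
lemma sum_mul_succSet_eq_sum_mul_precSet (x : Sym2 V → ℝ) (v : V) :
    ∑ e ∈ inc S.E v, x e * xS x (S.succSet v e) = ∑ e ∈ inc S.E v, x e * xS x (S.precSet v e) := by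
  simp only [xS, succSet, precSet, Finset.sum_filter, Finset.mul_sum]
  rw [Finset.sum_comm]
  refine Finset.sum_congr rfl fun e _ => Finset.sum_congr rfl fun f _ => ?_
  split_ifs <;> ring

lemma sum_mul_simSet_add_two_mul_succSet (x : Sym2 V → ℝ) (v : V) :
    ∑ e ∈ inc S.E v, x e * (xS x (S.simSet v e) + 2 * xS x (S.succSet v e)) =
      xS x (inc S.E v) ^ 2 := by
  have h : xS x (inc S.E v) ^ 2 = ∑ e ∈ inc S.E v, x e *
      (xS x (S.simSet v e) + xS x (S.succSet v e) + xS x (S.precSet v e)) := by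
    rw [sq]
    nth_rewrite 1 [xS]
    rw [Finset.sum_mul]
    exact Finset.sum_congr rfl fun e he => by rw [xS_inc_eq_add x he]
  simp only [h, mul_add, Finset.sum_add_distrib, ← sum_mul_succSet_eq_sum_mul_precSet]
  rw [add_assoc, ← Finset.sum_add_distrib (f := fun e => x e * xS x (S.succSet v e))]
  congr 1
  exact Finset.sum_congr rfl fun e _ => by ring

lemma sum_inc_eq_sum_vertex {x : Sym2 V → ℝ} (hx : S.IsVec x) (g : Sym2 V → ℝ) (v : V) :
    ∑ e ∈ inc S.E v, x e * g e = ∑ w, x s(v, w) * g s(v, w) := by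
  have hsub : inc S.E v ⊆ Finset.univ.image fun w => s(v, w) := by
    intro e he
    obtain ⟨w, rfl⟩ := (mem_inc.1 he).2
    simp
  rw [Finset.sum_subset hsub, Finset.sum_image]
  · intro a _ b _ h
    exact Sym2.congr_right.1 h
  · intro e he hne
    obtain ⟨w, -, rfl⟩ := Finset.mem_image.1 he
    rw [hx.2 _ fun h => hne (mem_inc.2 ⟨h, Sym2.mem_mk_left v w⟩), zero_mul]

lemma sum_vertex_mul_slack {x : Sym2 V → ℝ} (hx : S.IsVec x) :
    ∑ v, ∑ w, x s(v, w) * (xS x (S.simSet v s(v, w)) +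
      (xS x (S.succSet v s(v, w)) + xS x (S.succSet w s(v, w))) - 1) =
      ∑ v, (xS x (inc S.E v) ^ 2 - xS x (inc S.E v)) := by
  have hswap : ∑ v, ∑ w, x s(v, w) * xS x (S.succSet w s(v, w)) =
      ∑ v, ∑ w, x s(v, w) * xS x (S.succSet v s(v, w)) := by
    rw [Finset.sum_comm]
    simp only [Sym2.eq_swap]
  have hdeg (v : V) : xS x (inc S.E v) = ∑ w, x s(v, w) := by
    simpa [xS] using sum_inc_eq_sum_vertex hx (fun _ => 1) v
  have hsq (v : V) : xS x (inc S.E v) ^ 2 =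
      ∑ w, x s(v, w) * (xS x (S.simSet v s(v, w)) + 2 * xS x (S.succSet v s(v, w))) := by
    rw [← sum_mul_simSet_add_two_mul_succSet,
      sum_inc_eq_sum_vertex hx (fun e => xS x (S.simSet v e) + 2 * xS x (S.succSet v e))]
  simp only [hsq, Finset.sum_sub_distrib]
  simp only [hdeg, mul_sub, mul_add, mul_one, Finset.sum_sub_distrib, Finset.sum_add_distrib, hswap,
    mul_left_comm _ (2 : ℝ), ← Finset.mul_sum]
  ring

lemma slack_eq_zero {x : Sym2 V → ℝ} (hx : S.memP x) :
    (∀ v w, x s(v, w) * (xS x (S.simSet v s(v, w)) +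
      (xS x (S.succSet v s(v, w)) + xS x (S.succSet w s(v, w))) - 1) = 0) ∧
    ∀ v, xS x (inc S.E v) ^ 2 - xS x (inc S.E v) = 0 := by
  obtain ⟨hvec, h1, h2, -⟩ := hx
  have heq := sum_vertex_mul_slack hvec
  have hl : ∀ v w, 0 ≤ x s(v, w) * (xS x (S.simSet v s(v, w)) +
      (xS x (S.succSet v s(v, w)) + xS x (S.succSet w s(v, w))) - 1) := by
    intro v w
    by_cases h : s(v, w) ∈ S.E
    · exact mul_nonneg (hvec.1 _) (sub_nonneg.2 (h2 v w h))
    · simp [hvec.2 _ h]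
  have hr : ∀ v, xS x (inc S.E v) ^ 2 - xS x (inc S.E v) ≤ 0 := by
    intro v
    have : 0 ≤ xS x (inc S.E v) := Finset.sum_nonneg fun e _ => hvec.1 e
    nlinarith [h1 v]
  have hlv (v : V) := Finset.sum_nonneg fun w (_ : w ∈ Finset.univ) => hl v w
  have hL := Finset.sum_nonneg fun v (_ : v ∈ Finset.univ) => hlv v
  have hR := Finset.sum_nonpos fun v (_ : v ∈ Finset.univ) => hr v
  constructor
  · intro v w
    have hv := (Finset.sum_eq_zero_iff_of_nonneg fun v _ => hlv v).1
      (le_antisymm (heq.trans_le hR) hL) v (Finset.mem_univ v)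
    exact (Finset.sum_eq_zero_iff_of_nonneg fun w _ => hl v w).1 hv w (Finset.mem_univ w)
  · intro v
    exact (Finset.sum_eq_zero_iff_of_nonpos fun v _ => hr v).1
      (le_antisymm hR (hL.trans_eq heq)) v (Finset.mem_univ v)

lemma xS_precSet_eq_xS_succSet {x : Sym2 V → ℝ} (hx : S.memP x) {v w : V}
    (he : s(v, w) ∈ S.supp x) :
    xS x (S.precSet v s(v, w)) = xS x (S.succSet w s(v, w)) := by
  simp only [supp, Finset.mem_filter] at he
  obtain ⟨hs, hd⟩ := slack_eq_zero hx
  have hmem : s(v, w) ∈ inc S.E v := mem_inc.2 ⟨he.1, Sym2.mem_mk_left v w⟩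
  have hpos : 0 < xS x (inc S.E v) :=
    he.2.trans_le (Finset.single_le_sum (fun e _ => hx.1.1 e) hmem)
  have hone : xS x (inc S.E v) = 1 := by
    have : xS x (inc S.E v) * (xS x (inc S.E v) - 1) = 0 := by linear_combination hd v
    exact sub_eq_zero.1 ((mul_eq_zero.1 this).resolve_left hpos.ne')
  have htight := (mul_eq_zero.1 (hs v w)).resolve_left he.2.ne'
  linarith [xS_inc_eq_add x hmem]

open Classical in
lemma xS_filter_eq_zero_iff {x : Sym2 V → ℝ} (hx : S.IsVec x) (v : V) (p : Sym2 V → Prop) :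
    xS x ((inc S.E v).filter p) = 0 ↔ ∀ f ∈ inc (S.supp x) v, ¬ p f := by
  rw [xS, Finset.sum_eq_zero_iff_of_nonneg fun e _ => hx.1 e]
  simp only [Finset.mem_filter, mem_inc, supp]
  constructor
  · rintro h f ⟨⟨hf, hpos⟩, hv⟩ hp
    exact hpos.ne' (h f ⟨⟨hf, hv⟩, hp⟩)
  · rintro h f ⟨⟨hf, hv⟩, hp⟩
    by_contra hne
    exact h f ⟨⟨hf, (hx.1 f).lt_of_ne' hne⟩, hv⟩ hp

lemma inc_supp_subset (x : Sym2 V → ℝ) (v : V) : inc (S.supp x) v ⊆ inc S.E v := by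
  intro e
  simp only [mem_inc, supp, Finset.mem_filter]
  tauto

lemma not_sPref_iff {v : V} {e f : Sym2 V} (he : e ∈ inc S.E v) (hf : f ∈ inc S.E v) :
    ¬ S.SPref v (some e) (some f) ↔ S.pref v (some f) (some e) := by
  have := pref_or_pref he hf
  unfold SPref
  tauto

open Classical in
lemma mem_Wset_iff {x : Sym2 V → ℝ} (hx : S.IsVec x) {v : V} {e : Sym2 V}
    (he : e ∈ inc (S.supp x) v) : e ∈ S.Wset x v ↔ xS x (S.precSet v e) = 0 := by
  rw [precSet, xS_filter_eq_zero_iff hx, Wset, Finset.mem_filter, and_iff_right he]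
  exact forall₂_congr fun f hf =>
    (not_sPref_iff (inc_supp_subset x v he) (inc_supp_subset x v hf)).symm

open Classical in
lemma mem_Bset_iff {x : Sym2 V → ℝ} (hx : S.IsVec x) {v : V} {e : Sym2 V}
    (he : e ∈ inc (S.supp x) v) : e ∈ S.Bset x v ↔ xS x (S.succSet v e) = 0 := by
  rw [succSet, xS_filter_eq_zero_iff hx, Bset, Finset.mem_filter, and_iff_right he]
  exact forall₂_congr fun f hf =>
    (not_sPref_iff (inc_supp_subset x v hf) (inc_supp_subset x v he)).symm

end RSetup

open RSetup in
/-- (A4) of Lemma 9: for `x ∈ P` and an edge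
`e = {v, w} ∈ E⁺`, `e ∈ W_x(v)` iff `e ∈ B_x(w)`. -/
theorem mem_Wset_iff_mem_Bset
    {V : Type*} [Fintype V] [DecidableEq V] (S : RSetup V)
    (hP : ∃ y : Sym2 V → ℝ, S.memP y)
    (x : Sym2 V → ℝ) (hx : S.memP x)
    (v w : V) (he : s(v, w) ∈ S.Eplus) :
    s(v, w) ∈ S.Wset x v ↔ s(v, w) ∈ S.Bset x w := by
  by_cases h : s(v, w) ∈ S.supp x
  · rw [mem_Wset_iff hx.1 (mem_inc.2 ⟨h, Sym2.mem_mk_left v w⟩),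
      mem_Bset_iff hx.1 (mem_inc.2 ⟨h, Sym2.mem_mk_right v w⟩), xS_precSet_eq_xS_succSet hx h]
  · simp [Wset, Bset, mem_inc, h]
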